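/- arXiv:1510.02793 — 2 statements merged into one kernel-verified Lean document; each statement's English description precedes it below -/
import Mathlib

section
/- Let (X,d) be a separable metric space directionally (ξ,η,ζ)-limited at X and let ν be an asymptotically (α,γ)-bounded Borel measure on X (α ∈ (0,1], γ ≥ 1). Let μ be a positive Borel measure on X, fix ε₀ > 0, 0 < δ < ξ/2, A ⊂ X, and let ℱ_δ^A = { B_r(a) : a ∈ A, 0 < r ≤ δ, μ(B_r(a)) ≤ (γ + ε₀) μ(B_{αr}(a)) }. Then there exist a set A₀ ⊂ X with μ(A₀) = 0 and 2ζ+1 countable subfamilies 𝒢₁, …, 𝒢_{2ζ+1} of ℱ_δ^A, each consisting of pairwise disjoint closed balls, such that A ⊂ A₀ ∪ ∪_{j=1}^{2ζ+1} ∪_{B ∈ 𝒢_j} B. -/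
open MeasureTheory Metric Set Filter Topology ENNReal Bornology

/-- `(X,d)` is directionally `(ξ,η,ζ)`-limited at `A`: for every `a ∈ A` and every
`B ⊆ A ∩ (U_ξ(a) \ {a})` such that for all distinct `b, c ∈ B` with `d(a,b) ≥ d(a,c)`,
every `x` with `d(a,x) = d(a,c)` and `d(a,x) + d(x,b) = d(a,b)` satisfies
`d(x,c)/d(a,c) ≥ η`, the set `B` has cardinality at most `ζ`. -/
def DirLimited {X : Type*} [MetricSpace X] (A : Set X) (ξ η : ℝ) (ζ : ℕ) : Prop :=
  ∀ a ∈ A, ∀ B : Set X, B ⊆ A ∩ (Metric.ball a ξ \ {a}) →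
    (∀ b ∈ B, ∀ c ∈ B, b ≠ c → dist a c ≤ dist a b →
      ∀ x : X, dist a x = dist a c → dist a x + dist x b = dist a b →
        η ≤ dist x c / dist a c) →
    B.Finite ∧ B.ncard ≤ ζ
/-- `ν` is asymptotically `(α,γ)`-bounded: finite on bounded sets, strictly positive on
balls of positive radius, and `limsup_{r→0⁺} ν(B_r(x))/ν(B_{αr}(x)) ≤ γ` for all `x`. -/
def AsympBounded {X : Type*} [MetricSpace X] [MeasurableSpace X]
    (ν : MeasureTheory.Measure X) (α γ : ℝ) : Prop :=
  (∀ s : Set X, Bornology.IsBounded s → ν s < ⊤) ∧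
  (∀ (x : X) (r : ℝ), 0 < r → 0 < ν (Metric.closedBall x r)) ∧
  (∀ x : X, Filter.limsup
      (fun r : ℝ => ν (Metric.closedBall x r) / ν (Metric.closedBall x (α * r)))
      (nhdsWithin 0 (Set.Ioi 0)) ≤ ENNReal.ofReal γ)

universe u

/-- Variant of `Besicovitch.TauPackage.color_lt` which only excludes the satellite configurations
whose radii do not exceed the bound of the package. -/
theorem Besicovitch.TauPackage.color_lt_of_bounded {α : Type*} [MetricSpace α] {β : Type u}
    [Nonempty β] (p : TauPackage β α) {i : Ordinal.{u}} (hi : i < p.lastStep) {N : ℕ}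
    (hN : ∀ S : SatelliteConfig α N p.τ, ¬ ∀ k, S.r k ≤ p.r_bound) : p.color i < N := by
  induction i using WellFoundedLT.induction with | ind i IH
  let A : Set ℕ :=
    ⋃ (j : { j // j < i })
      (_ : (closedBall (p.c (p.index j)) (p.r (p.index j)) ∩
        closedBall (p.c (p.index i)) (p.r (p.index i))).Nonempty),
      {p.color j}
  have color_i : p.color i = sInf (univ \ A) := by rw [color]
  rw [color_i]
  have N_mem : N ∈ univ \ A := by
    simp only [A, not_exists, true_and, exists_prop, mem_iUnion, mem_singleton_iff,
      not_and, mem_univ, Set.mem_sdiff, Subtype.exists]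
    intro j ji _
    exact (IH j ji (ji.trans hi)).ne'
  suffices sInf (univ \ A) ≠ N by
    rcases (csInf_le (OrderBot.bddBelow (univ \ A)) N_mem).lt_or_eq with (H | H)
    · exact H
    · exact (this H).elim
  intro Inf_eq_N
  have :
    ∀ k, k < N → ∃ j, j < i ∧
      (closedBall (p.c (p.index j)) (p.r (p.index j)) ∩
        closedBall (p.c (p.index i)) (p.r (p.index i))).Nonempty ∧ k = p.color j := by
    intro k hk
    rw [← Inf_eq_N] at hk
    have : k ∈ A := by
      simpa only [true_and, mem_univ, Classical.not_not, Set.mem_sdiff] using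
        Nat.notMem_of_lt_sInf hk
    simpa only [A, exists_prop, mem_iUnion, mem_singleton_iff, mem_closedBall, Subtype.exists,
      Subtype.coe_mk]
  choose! g hg using this
  -- Choose for each `k < N` an ordinal `G k < i` giving a ball of color `k` intersecting
  -- the last ball.
  let G : ℕ → Ordinal := fun n => if n = N then i else g n
  have color_G : ∀ n, n ≤ N → p.color (G n) = n := by
    intro n hn
    rcases hn.eq_or_lt with (rfl | H)
    · simp only [G]; simp only [color_i, Inf_eq_N, if_true]
    · simp only [G]; simp only [H.ne, (hg n H).right.right.symm, if_false]
  have G_lt_last : ∀ n, n ≤ N → G n < p.lastStep := by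
    intro n hn
    rcases hn.eq_or_lt with (rfl | H)
    · simp only [G]; simp only [hi, if_true]
    · simp only [G]; simp only [H.ne, (hg n H).left.trans hi, if_false]
  have fGn :
      ∀ n, n ≤ N →
        p.c (p.index (G n)) ∉ p.iUnionUpTo (G n) ∧ p.R (G n) ≤ p.τ * p.r (p.index (G n)) := by
    intro n hn
    have :
      p.index (G n) =
        Classical.epsilon fun t => p.c t ∉ p.iUnionUpTo (G n) ∧ p.R (G n) ≤ p.τ * p.r t := by
      rw [index]; rfl
    rw [this]
    have : ∃ t, p.c t ∉ p.iUnionUpTo (G n) ∧ p.R (G n) ≤ p.τ * p.r t := by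
      simpa only [not_exists, exists_prop, not_and, not_lt, not_le, mem_ofPred_eq, not_forall] using
        notMem_of_lt_csInf (G_lt_last n hn) (OrderBot.bddBelow _)
    exact Classical.epsilon_spec this
  -- the balls with indices `G k` satisfy the characteristic property of satellite configurations.
  have Gab :
    ∀ a b : Fin (Nat.succ N),
      G a < G b →
        p.r (p.index (G a)) ≤ dist (p.c (p.index (G a))) (p.c (p.index (G b))) ∧
          p.r (p.index (G b)) ≤ p.τ * p.r (p.index (G a)) := by
    intro a b G_lt
    have ha : (a : ℕ) ≤ N := Nat.lt_succ_iff.1 a.2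
    have hb : (b : ℕ) ≤ N := Nat.lt_succ_iff.1 b.2
    constructor
    · have := (fGn b hb).1
      simp only [iUnionUpTo, not_exists, exists_prop, mem_iUnion, not_and,
        Subtype.exists] at this
      simpa only [dist_comm, mem_ball, not_lt] using this (G a) G_lt
    · apply le_trans _ (fGn a ha).2
      have B : p.c (p.index (G b)) ∉ p.iUnionUpTo (G a) := by
        intro H; exact (fGn b hb).1 (p.monotone_iUnionUpTo G_lt.le H)
      let b' : { t // p.c t ∉ p.iUnionUpTo (G a) } := ⟨p.index (G b), B⟩
      apply @le_ciSup _ _ _ (fun t : { t // p.c t ∉ p.iUnionUpTo (G a) } => p.r t) _ b'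
      refine ⟨p.r_bound, fun t ht => ?_⟩
      simp only [exists_prop, mem_range, Subtype.exists] at ht
      rcases ht with ⟨u, hu⟩
      rw [← hu.2]
      exact p.r_le _
  -- therefore, one may use them to construct a satellite configuration with `N+1` points
  let sc : SatelliteConfig α N p.τ :=
    { c := fun k => p.c (p.index (G k))
      r := fun k => p.r (p.index (G k))
      rpos := fun k => p.rpos (p.index (G k))
      h := by
        intro a b a_ne_b
        wlog G_le : G a ≤ G b generalizing a b
        · exact (this a_ne_b.symm (le_of_not_ge G_le)).symm
        have G_lt : G a < G b := by
          rcases G_le.lt_or_eq with (H | H); · exact H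
          have A : (a : ℕ) ≠ b := Fin.val_injective.ne a_ne_b
          rw [← color_G a (Nat.lt_succ_iff.1 a.2), ← color_G b (Nat.lt_succ_iff.1 b.2), H] at A
          exact (A rfl).elim
        exact Or.inl (Gab a b G_lt)
      hlast := by
        intro a ha
        have I : (a : ℕ) < N := ha
        have : G a < G (Fin.last N) := by simp [G, I.ne, (hg a I).1]
        exact Gab _ _ this
      inter := by
        intro a ha
        have I : (a : ℕ) < N := ha
        have J : G (Fin.last N) = i := by dsimp; simp only [G, if_true]
        have K : G a = g a := by simp [G, I.ne]
        convert! dist_le_add_of_nonempty_closedBall_inter_closedBall (hg _ I).2.1 }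
  -- this is a contradiction
  exact hN sc fun _ => p.r_le _

/-- Variant of `Besicovitch.exist_disjoint_covering_families` which only excludes the satellite
configurations whose radii do not exceed the bound of the package. -/
theorem Besicovitch.exist_disjoint_covering_families_of_bounded {α : Type*} [MetricSpace α]
    {β : Type u} {N : ℕ} {τ : ℝ} (hτ : 1 < τ) (q : BallPackage β α)
    (hN : ∀ S : SatelliteConfig α N τ, ¬ ∀ k, S.r k ≤ q.r_bound) :
    ∃ s : Fin N → Set β,
      (∀ i : Fin N, (s i).PairwiseDisjoint fun j => closedBall (q.c j) (q.r j)) ∧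
        range q.c ⊆ ⋃ i : Fin N, ⋃ j ∈ s i, ball (q.c j) (q.r j) := by
  -- first exclude the trivial case where `β` is empty (we need non-emptiness for the transfinite
  -- induction, to be able to choose garbage when there is no point left).
  cases isEmpty_or_nonempty β
  · refine ⟨fun _ => ∅, fun _ => pairwiseDisjoint_empty, ?_⟩
    rw [← image_univ, eq_empty_of_isEmpty (univ : Set β)]
    simp
  -- Now, assume `β` is nonempty.
  let p : TauPackage β α :=
    { q with
      τ
      one_lt_tau := hτ }
  -- we use for `s i` the balls of color `i`.
  let s := fun i : Fin N =>
    ⋃ (k : Ordinal.{u}) (_ : k < p.lastStep) (_ : p.color k = i), ({p.index k} : Set β)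
  refine ⟨s, fun i => ?_, ?_⟩
  · -- show that balls of the same color are disjoint
    intro x hx y hy x_ne_y
    obtain ⟨jx, jx_lt, jxi, rfl⟩ :
      ∃ jx : Ordinal, jx < p.lastStep ∧ p.color jx = i ∧ x = p.index jx := by
      simpa only [s, exists_prop, mem_iUnion, mem_singleton_iff] using hx
    obtain ⟨jy, jy_lt, jyi, rfl⟩ :
      ∃ jy : Ordinal, jy < p.lastStep ∧ p.color jy = i ∧ y = p.index jy := by
      simpa only [s, exists_prop, mem_iUnion, mem_singleton_iff] using hy
    wlog jxy : jx ≤ jy generalizing jx jy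
    · exact (this jy jy_lt jyi hy jx jx_lt jxi hx x_ne_y.symm (le_of_not_ge jxy)).symm
    replace jxy : jx < jy := by
      rcases lt_or_eq_of_le jxy with (H | rfl); · { exact H }; · { exact (x_ne_y rfl).elim }
    let A : Set ℕ :=
      ⋃ (j : { j // j < jy })
        (_ : (closedBall (p.c (p.index j)) (p.r (p.index j)) ∩
          closedBall (p.c (p.index jy)) (p.r (p.index jy))).Nonempty),
        {p.color j}
    have color_j : p.color jy = sInf (univ \ A) := by rw [TauPackage.color]
    have h : p.color jy ∈ univ \ A := by
      rw [color_j]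
      apply csInf_mem
      refine ⟨N, ?_⟩
      simp only [A, not_exists, true_and, exists_prop, mem_iUnion, mem_singleton_iff, not_and,
        mem_univ, Set.mem_sdiff, Subtype.exists]
      intro k hk _
      exact (p.color_lt_of_bounded (hk.trans jy_lt) hN).ne'
    simp only [A, not_exists, true_and, exists_prop, mem_iUnion, mem_singleton_iff, not_and,
      mem_univ, Set.mem_sdiff, Subtype.exists] at h
    specialize h jx jxy
    contrapose! h
    simpa only [jxi, jyi, and_true, eq_self_iff_true, ← not_disjoint_iff_nonempty_inter] using h
  · -- show that the balls of color at most `N` cover every center.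
    refine range_subset_iff.2 fun b => ?_
    obtain ⟨a, ha⟩ :
      ∃ a : Ordinal, a < p.lastStep ∧ dist (p.c b) (p.c (p.index a)) < p.r (p.index a) := by
      simpa only [TauPackage.iUnionUpTo, exists_prop, mem_iUnion, mem_ball, Subtype.exists,
        Subtype.coe_mk] using p.mem_iUnionUpTo_lastStep b
    simp only [s, exists_prop, mem_iUnion, mem_ball, mem_singleton_iff, biUnion_and',
      exists_eq_left, iUnion_exists, exists_and_left]
    exact ⟨⟨p.color a, p.color_lt_of_bounded ha.1 hN⟩, a, rfl, ha⟩

section DirLimited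

variable {X : Type*} [MetricSpace X] {ξ η δ : ℝ} {ζ : ℕ}

theorem Besicovitch.SatelliteConfig.le_dist_div_dist {N : ℕ}
    (S : SatelliteConfig X N (26 / 25)) (hη' : η ≤ 1 / 3) {i j : Fin N} (hij : i ≠ j)
    (h : 8 / 5 * S.r (Fin.last N) ≤ dist (S.c (Fin.last N)) (S.c j.castSucc) ∨
      dist (S.c (Fin.last N)) (S.c i.castSucc) ≤ 8 / 5 * S.r (Fin.last N))
    {x : X} (hx : dist (S.c (Fin.last N)) x = dist (S.c (Fin.last N)) (S.c j.castSucc))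
    (hxi : dist (S.c (Fin.last N)) x + dist x (S.c i.castSucc) =
      dist (S.c (Fin.last N)) (S.c i.castSucc)) :
    η ≤ dist x (S.c j.castSucc) / dist (S.c (Fin.last N)) (S.c j.castSucc) := by
  have hi := S.hlast _ i.castSucc_lt_last
  have hj := S.hlast _ j.castSucc_lt_last
  have ii := S.inter _ i.castSucc_lt_last
  have ij := S.inter _ j.castSucc_lt_last
  have hh := S.h ((Fin.castSucc_injective N).ne hij)
  beta_reduce at hh
  have tri := dist_triangle_left (S.c i.castSucc) (S.c j.castSucc) x
  have pi := S.rpos i.castSucc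
  have pj := S.rpos j.castSucc
  have pl := S.rpos (Fin.last N)
  rw [dist_comm (S.c j.castSucc) (S.c i.castSucc)] at hh
  rw [dist_comm _ (S.c (Fin.last N))] at hi hj ii ij
  generalize dist (S.c (Fin.last N)) (S.c i.castSucc) = b at *
  generalize dist (S.c (Fin.last N)) (S.c j.castSucc) = c at *
  generalize dist (S.c i.castSucc) (S.c j.castSucc) = e at *
  generalize dist x (S.c i.castSucc) = f at *
  have hc : 0 < c := by linarith
  rw [le_div_iff₀ hc]
  have : η * c ≤ 1 / 3 * c := by gcongr
  by_contra! hlt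
  rcases hh with hh | hh <;> rcases h with h | h <;> linarith

/-- In a directionally limited space there is no satellite configuration of small balls with more
than `2 * ζ` satellites: at most `ζ` of them are close to the last ball, and at most `ζ` far. -/
theorem DirLimited.not_satelliteConfig (hη' : η ≤ 1 / 3)
    (hdir : DirLimited (univ : Set X) ξ η ζ) (hδξ : δ < ξ / 2)
    (S : Besicovitch.SatelliteConfig X (2 * ζ + 1) (26 / 25)) : ¬ ∀ k, S.r k ≤ δ := by
  intro hS
  set a := S.c (Fin.last (2 * ζ + 1))
  have inj : Function.Injective fun i : Fin (2 * ζ + 1) => S.c i.castSucc := by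
    intro i j hij
    by_contra hne
    have hh := S.h ((Fin.castSucc_injective _).ne hne)
    have pi := S.rpos i.castSucc
    have pj := S.rpos j.castSucc
    beta_reduce at hij hh
    rw [hij, dist_self] at hh
    rcases hh with hh | hh <;> linarith [hh.1]
  have card_le (P : Set (Fin (2 * ζ + 1)))
      (hP : ∀ i ∈ P, ∀ j ∈ P, 8 / 5 * S.r (Fin.last _) ≤ dist a (S.c j.castSucc) ∨
        dist a (S.c i.castSucc) ≤ 8 / 5 * S.r (Fin.last _)) : P.ncard ≤ ζ := by
    rw [← ncard_image_of_injective P inj]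
    refine (hdir a (mem_univ _) _ ?_ ?_).2
    · rintro _ ⟨i, -, rfl⟩
      have h1 := S.hlast _ i.castSucc_lt_last
      have h2 := S.inter _ i.castSucc_lt_last
      have h3 := S.rpos i.castSucc
      refine ⟨mem_univ _, ?_, fun h => ?_⟩
      · rw [mem_ball]
        linarith [hS i.castSucc, hS (Fin.last _)]
      · have h4 : S.c i.castSucc = a := h
        rw [h4, dist_self] at h1
        linarith [h1.1]
    · rintro _ ⟨i, hi, rfl⟩ _ ⟨j, hj, rfl⟩ hne _ x hx hxi
      exact S.le_dist_div_dist hη' (fun h => hne (by rw [h])) (hP i hi j hj) hx hxi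
  let P : Set (Fin (2 * ζ + 1)) :=
    {i | 8 / 5 * S.r (Fin.last _) ≤ dist a (S.c i.castSucc)}
  have h1 := card_le P fun i _ j hj => Or.inl hj
  have h2 := card_le Pᶜ fun i hi j _ => Or.inr (le_of_not_ge fun h => hi h)
  have h3 := ncard_add_ncard_compl P
  rw [Nat.card_fin] at h3
  omega

/-- The Besicovitch covering theorem in directionally limited spaces. -/
theorem DirLimited.exists_disjoint_covering_families [TopologicalSpace.SeparableSpace X]
    (hη' : η ≤ 1 / 3) (hdir : DirLimited (univ : Set X) ξ η ζ) (hδξ : δ < ξ / 2)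
    (s : Set X) (r : X → ℝ) (hr : ∀ a ∈ s, 0 < r a ∧ r a ≤ δ) :
    ∃ t : Fin (2 * ζ + 1) → Set X, (∀ j, t j ⊆ s) ∧ (∀ j, (t j).Countable) ∧
      (∀ j, (t j).PairwiseDisjoint fun a => closedBall a (r a)) ∧
      s ⊆ ⋃ j, ⋃ a ∈ t j, closedBall a (r a) := by
  obtain ⟨t, ht, hcov⟩ := Besicovitch.exist_disjoint_covering_families_of_bounded
    (by norm_num : (1 : ℝ) < 26 / 25)
    (⟨Subtype.val, fun a : s => r a, fun a => (hr a a.2).1, δ, fun a => (hr a a.2).2⟩ :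
      Besicovitch.BallPackage s X) (hdir.not_satelliteConfig hη' hδξ)
  have hsub (j) : Subtype.val '' t j ⊆ s := by
    rintro _ ⟨a, -, rfl⟩
    exact a.2
  have hdisj (j) : (Subtype.val '' t j).PairwiseDisjoint fun a => closedBall a (r a) := by
    rintro _ ⟨a, ha, rfl⟩ _ ⟨b, hb, rfl⟩ hab
    exact ht j ha hb fun h => hab (by rw [h])
  refine ⟨fun j => Subtype.val '' t j, hsub, fun j => ?_, hdisj, fun a ha => ?_⟩
  · refine (hdisj j).countable_of_nonempty_interior fun a ha => ?_
    exact (nonempty_ball.2 (hr a (hsub j ha)).1).mono ball_subset_interior_closedBall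
  · obtain ⟨j, b, hb, hab⟩ : ∃ j, ∃ b ∈ t j, a ∈ ball (b : X) (r b) := by
      simpa using hcov ⟨⟨a, ha⟩, rfl⟩
    simp only [mem_iUnion]
    exact ⟨j, b, mem_image_of_mem _ hb, ball_subset_closedBall hab⟩

end DirLimited

section Null

variable {X : Type*} [MetricSpace X] [MeasurableSpace X]

/-- If the ratio of the measures of the balls of radii `r` and `α * r` is asymptotically at most `γ`
for `ν`, but greater than a number larger than `γ` for `μ`, then `μ` is small compared to `ν` on
some small balls. -/
theorem AsympBounded.exists_measure_closedBall_le {ν μ : Measure X} {α γ ε₀ δ : ℝ}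
    (hν : AsympBounded ν α γ) (hα : 0 < α) (hα1 : α < 1) (hγ : 1 ≤ γ) (hε₀ : 0 < ε₀)
    (hδ : 0 < δ) {a : X}
    (ha : ∀ r, 0 < r → r ≤ δ → ENNReal.ofReal (γ + ε₀) * μ (closedBall a (α * r)) <
      μ (closedBall a r))
    {ε : ℝ≥0∞} (hε : 0 < ε) {ρ : ℝ} (hρ : 0 < ρ) :
    ∃ r, 0 < r ∧ r ≤ ρ ∧ μ (closedBall a r) ≤ ε * ν (closedBall a r) := by
  obtain ⟨hfin, hpos, hlim⟩ := hν
  set q := ENNReal.ofReal (γ + ε₀) with hq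
  set p := ENNReal.ofReal (γ + ε₀ / 2) with hp
  have p0 : p ≠ 0 := by simp [hp]; linarith
  have q0 : q ≠ 0 := by simp [hq]; linarith
  have pt : p ≠ ⊤ := ofReal_ne_top
  have qt : q ≠ ⊤ := ofReal_ne_top
  have hpq : p < q := (ENNReal.ofReal_lt_ofReal_iff (by linarith)).2 (by linarith)
  have hγp : ENNReal.ofReal γ < p := (ENNReal.ofReal_lt_ofReal_iff (by linarith)).2 (by linarith)
  have hev := eventually_lt_of_limsup_lt ((hlim a).trans_lt hγp)
  obtain ⟨r₀, hr₀, hr₀'⟩ := mem_nhdsGT_iff_exists_Ioo_subset.1 hev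
  have hr₀ : 0 < r₀ := hr₀
  have doubling : ∀ r, 0 < r → r < r₀ →
      ν (closedBall a r) ≤ p * ν (closedBall a (α * r)) := by
    intro r h h'
    have : ν (closedBall a r) / ν (closedBall a (α * r)) < p := hr₀' ⟨h, h'⟩
    exact (ENNReal.div_le_iff (hpos _ _ (by positivity)).ne' (hfin _ isBounded_closedBall).ne).1
      this.le
  set m := min (r₀ / 2) δ
  have m0 : 0 < m := lt_min (by linarith) hδ
  have mr : m < r₀ := (min_le_left _ _).trans_lt (by linarith)
  have mδ : m ≤ δ := min_le_right _ _
  have hpow (k : ℕ) : 0 < α ^ k * (α * m) := by positivity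
  have hpow' (k : ℕ) : α ^ k * (α * m) ≤ m := by
    have : α ^ k * α ≤ 1 := by
      rw [← pow_succ]
      exact pow_le_one₀ hα.le hα1.le
    nlinarith
  have hM : μ (closedBall a (α * m)) ≠ ⊤ := by
    intro h
    have := ha m m0 mδ
    rw [h, ENNReal.mul_top q0] at this
    exact not_top_lt this
  have hμ (k : ℕ) : q ^ k * μ (closedBall a (α ^ k * (α * m))) ≤ μ (closedBall a (α * m)) := by
    induction k with
    | zero => simp
    | succ k ih =>
      refine le_trans ?_ ih
      rw [pow_succ, mul_assoc, pow_succ' α, mul_assoc]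
      gcongr
      exact (ha _ (hpow k) ((hpow' k).trans mδ)).le
  have hν (k : ℕ) : ν (closedBall a (α * m)) ≤ p ^ k * ν (closedBall a (α ^ k * (α * m))) := by
    induction k with
    | zero => simp
    | succ k ih =>
      refine ih.trans ?_
      rw [pow_succ, mul_assoc, pow_succ' α, mul_assoc]
      gcongr
      exact doubling _ (hpow k) ((hpow' k).trans_lt mr)
  have lim₁ : Tendsto (fun k : ℕ => (p / q) ^ k * μ (closedBall a (α * m))) atTop (𝓝 0) := by
    have := ENNReal.Tendsto.mul_const (b := μ (closedBall a (α * m)))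
      (ENNReal.tendsto_pow_atTop_nhds_zero_of_lt_one
        ((ENNReal.div_lt_iff (Or.inl q0) (Or.inl qt)).2 (by rwa [one_mul]))) (Or.inr hM)
    rwa [zero_mul] at this
  have lim₂ : Tendsto (fun k : ℕ => α ^ k * (α * m)) atTop (𝓝 0) := by
    simpa using (tendsto_pow_atTop_nhds_zero_of_lt_one hα.le hα1).mul_const (α * m)
  have hεV : 0 < ε * ν (closedBall a (α * m)) :=
    ENNReal.mul_pos hε.ne' (hpos _ _ (by positivity)).ne'
  obtain ⟨k, hk₁, hk₂⟩ :=
    ((lim₁.eventually (gt_mem_nhds hεV)).and (lim₂.eventually (gt_mem_nhds hρ))).exists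
  refine ⟨_, hpow k, hk₂.le, ?_⟩
  refine (ENNReal.mul_le_mul_iff_right (a := p ^ k * q ^ k) (by simp [p0, q0])
    (ENNReal.mul_ne_top (ENNReal.pow_ne_top pt) (ENNReal.pow_ne_top qt))).1 ?_
  calc p ^ k * q ^ k * μ (closedBall a (α ^ k * (α * m)))
      ≤ p ^ k * μ (closedBall a (α * m)) := by
        rw [mul_assoc]
        gcongr
        exact hμ k
    _ = q ^ k * ((p / q) ^ k * μ (closedBall a (α * m))) := by
        rw [← mul_assoc, ← mul_pow, ENNReal.mul_div_cancel q0 qt]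
    _ ≤ q ^ k * (ε * (p ^ k * ν (closedBall a (α ^ k * (α * m))))) := by
        exact mul_le_mul' le_rfl (hk₁.le.trans (mul_le_mul' le_rfl (hν k)))
    _ = p ^ k * q ^ k * (ε * ν (closedBall a (α ^ k * (α * m)))) := by ring

/-- In a directionally limited space, a set whose points are centers of arbitrarily small balls on
which `μ` is arbitrarily small compared to `ν` is `μ`-null. -/
theorem DirLimited.measure_eq_zero [BorelSpace X] [TopologicalSpace.SeparableSpace X]
    {ξ η : ℝ} {ζ : ℕ} (hξ : 0 < ξ) (hη' : η ≤ 1 / 3)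
    (hdir : DirLimited (univ : Set X) ξ η ζ) {μ ν : Measure X}
    (hfin : ∀ s : Set X, IsBounded s → ν s < ⊤) {s : Set X}
    (hs : ∀ a ∈ s, ∀ ε : ℝ≥0∞, 0 < ε → ∀ ρ : ℝ, 0 < ρ →
      ∃ r, 0 < r ∧ r ≤ ρ ∧ μ (closedBall a r) ≤ ε * ν (closedBall a r)) :
    μ s = 0 := by
  rcases s.eq_empty_or_nonempty with rfl | ⟨x₀, -⟩
  · exact measure_empty
  have hball (n : ℕ) : μ (s ∩ ball x₀ n) = 0 := by
    set V := ν (ball x₀ (n + ξ))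
    have hVt : V ≠ ⊤ := (hfin _ isBounded_ball).ne
    have bound (ε : ℝ≥0∞) (hε : 0 < ε) : μ (s ∩ ball x₀ n) ≤ ε * ((2 * ζ + 1 : ℕ) * V) := by
      choose! r hr using fun a (ha : a ∈ s) => hs a ha ε hε (ξ / 4) (by positivity)
      obtain ⟨t, hts, htc, htd, hcov⟩ := hdir.exists_disjoint_covering_families hη'
        (by linarith : ξ / 4 < ξ / 2) (s ∩ ball x₀ n) r
        fun a ha => ⟨(hr a ha.1).1, (hr a ha.1).2.1⟩
      have hj (j) : μ (⋃ a ∈ t j, closedBall a (r a)) ≤ ε * V := by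
        calc μ (⋃ a ∈ t j, closedBall a (r a))
            ≤ ∑' a : t j, μ (closedBall a (r a)) := measure_biUnion_le _ (htc j) _
          _ ≤ ∑' a : t j, ε * ν (closedBall a (r a)) :=
            ENNReal.tsum_le_tsum fun a => (hr a (hts j a.2).1).2.2
          _ = ε * ν (⋃ a ∈ t j, closedBall a (r a)) := by
            rw [ENNReal.tsum_mul_left,
              measure_biUnion (htc j) (htd j) fun _ _ => measurableSet_closedBall]
          _ ≤ ε * V := by
            refine mul_le_mul' le_rfl (measure_mono (iUnion₂_subset fun a ha y hy => ?_))
            have h1 := (hr a (hts j ha).1).2.1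
            have h2 : dist a x₀ < n := (hts j ha).2
            rw [mem_closedBall] at hy
            rw [mem_ball]
            linarith [dist_triangle y a x₀]
      calc μ (s ∩ ball x₀ n) ≤ μ (⋃ j, ⋃ a ∈ t j, closedBall a (r a)) := measure_mono hcov
        _ ≤ ∑ j, μ (⋃ a ∈ t j, closedBall a (r a)) := measure_iUnion_fintype_le _ _
        _ ≤ ∑ _j : Fin (2 * ζ + 1), ε * V := Finset.sum_le_sum fun j _ => hj j
        _ = ε * ((2 * ζ + 1 : ℕ) * V) := by
          rw [Finset.sum_const, Finset.card_univ, Fintype.card_fin, nsmul_eq_mul]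
          ring
    have hlim : Tendsto (fun ε : ℝ≥0∞ => ε * ((2 * ζ + 1 : ℕ) * V)) (𝓝[>] 0) (𝓝 0) := by
      have := ENNReal.Tendsto.mul_const (b := (2 * ζ + 1 : ℕ) * V) (tendsto_id (x := 𝓝 (0 : ℝ≥0∞)))
        (Or.inr (ENNReal.mul_ne_top (natCast_ne_top _) hVt))
      rw [zero_mul] at this
      exact this.mono_left nhdsWithin_le_nhds
    exact le_antisymm (ge_of_tendsto hlim (eventually_nhdsWithin_of_forall bound)) zero_le
  refine measure_mono_null ?_ (measure_iUnion_null hball)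
  rw [← inter_iUnion, iUnion_ball_nat, inter_univ]

end Null

/-- Besicovitch with doubling balls, covering part: there are a `μ`-null set
`A₀` and `2ζ+1` countable families of pairwise disjoint closed balls from
`ℱ_δ^A = {B_r(a) : a ∈ A, 0 < r ≤ δ, μ(B_r(a)) ≤ (γ+ε₀) μ(B_{αr}(a))}` covering `A \ A₀`. -/
theorem stmt12 {X : Type*} [MetricSpace X] [MeasurableSpace X] [BorelSpace X]
    [TopologicalSpace.SeparableSpace X]
    (ξ η : ℝ) (ζ : ℕ) (hξ : 0 < ξ) (hη : 0 < η) (hη' : η ≤ 1/3) (hζ : 0 < ζ)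
    (hdir : DirLimited (Set.univ : Set X) ξ η ζ)
    (ν : Measure X) (α γ : ℝ) (hα : 0 < α) (hα1 : α ≤ 1) (hγ : 1 ≤ γ)
    (hν : AsympBounded ν α γ)
    (μ : Measure X) (ε₀ δ : ℝ) (hε₀ : 0 < ε₀) (hδ : 0 < δ) (hδξ : δ < ξ / 2)
    (A : Set X) :
    ∃ (A₀ : Set X) (G : Fin (2 * ζ + 1) → Set (X × ℝ)),
      μ A₀ = 0 ∧
      (∀ j, (G j).Countable) ∧
      (∀ j, ∀ p ∈ G j, p.1 ∈ A ∧ 0 < p.2 ∧ p.2 ≤ δ ∧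
        μ (Metric.closedBall p.1 p.2) ≤
          ENNReal.ofReal (γ + ε₀) * μ (Metric.closedBall p.1 (α * p.2))) ∧
      (∀ j, (G j).Pairwise fun p p' =>
        Disjoint (Metric.closedBall p.1 p.2) (Metric.closedBall p'.1 p'.2)) ∧
      A ⊆ A₀ ∪ ⋃ j, ⋃ p ∈ G j, Metric.closedBall p.1 p.2 := by
  let D : Set X := {a | ∃ r, 0 < r ∧ r ≤ δ ∧ μ (closedBall a r) ≤
    ENNReal.ofReal (γ + ε₀) * μ (closedBall a (α * r))}
  have hnull : μ Dᶜ = 0 := by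
    rcases hα1.lt_or_eq with hα1 | rfl
    · refine hdir.measure_eq_zero hξ hη' hν.1 fun a ha ε hε ρ hρ =>
        hν.exists_measure_closedBall_le hα hα1 hγ hε₀ hδ (fun r h h' => ?_) hε hρ
      by_contra! hle
      exact ha ⟨r, h, h', hle⟩
    · have : D = univ := eq_univ_of_forall fun a =>
        ⟨δ, hδ, le_rfl, by
          rw [one_mul]
          exact le_mul_of_one_le_left zero_le (ENNReal.one_le_ofReal.2 (by linarith))⟩
      simp [this]
  choose! r hr using fun a (ha : a ∈ D) => ha
  obtain ⟨t, hts, htc, htd, hcov⟩ := hdir.exists_disjoint_covering_families hη' hδξ (A ∩ D) r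
    fun a ha => ⟨(hr a ha.2).1, (hr a ha.2).2.1⟩
  refine ⟨Dᶜ, fun j => (fun a => (a, r a)) '' t j, hnull, fun j => (htc j).image _, ?_, ?_, ?_⟩
  · rintro j _ ⟨a, ha, rfl⟩
    exact ⟨(hts j ha).1, hr a (hts j ha).2⟩
  · rintro j _ ⟨a, ha, rfl⟩ _ ⟨b, hb, rfl⟩ hab
    exact htd j ha hb fun h => hab (by rw [h])
  · intro a ha
    by_cases haD : a ∈ D
    · refine Or.inr ?_
      simpa using hcov ⟨ha, haD⟩
    · exact Or.inl haD
end

section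
/- Let (X,d) be a separable metric space directionally (ξ,η,ζ)-limited at X and endowed with an asymptotically (α,γ)-bounded Borel measure ν (α ∈ (0,1], γ ≥ 1). Let μ be a positive Borel measure on X and let q be a premeasure on closed balls satisfying C^{-1} μ(B_{αr}(x)) ≤ q(B_r(x)) ≤ C μ(B_r(x)) for some C ≥ 1, r₀ > 0, all x ∈ X and all 0 < r < r₀. Then for every Borel set A ⊂ X, (1/(γC)) μ(A) ≤ ĥμ^q(A) ≤ C · inf{ μ(U) : A ⊂ U, U open }. In particular, if μ is outer regular then (1/(γC)) μ(A) ≤ ĥμ^q(A) ≤ C μ(A) for every Borel set A. -/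
open MeasureTheory Metric Set Filter Topology ENNReal Bornology

/-- A packing of the open set `U` of order `δ`: a countable family of pairwise disjoint
closed balls, each of positive radius at most `δ` and contained in `U`, encoded as a
countable set of (center, radius) pairs. -/
def IsPackingOf {X : Type*} [MetricSpace X] (U : Set X) (δ : ℝ) (P : Set (X × ℝ)) : Prop :=
  P.Countable ∧ (∀ p ∈ P, 0 < p.2 ∧ p.2 ≤ δ ∧ Metric.closedBall p.1 p.2 ⊆ U) ∧
  P.Pairwise fun p p' => Disjoint (Metric.closedBall p.1 p.2) (Metric.closedBall p'.1 p'.2)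

/-- `ĥμ^q_δ(U)`: supremum of `∑_{B ∈ ℱ} q(B)` over packings `ℱ` of `U` of order `δ`. -/
noncomputable def packPre {X : Type*} [MetricSpace X] (q : X → ℝ → ℝ≥0∞) (δ : ℝ)
    (U : Set X) : ℝ≥0∞ :=
  ⨆ (P : Set (X × ℝ)) (_ : IsPackingOf U δ P), ∑' p : P, q p.1.1 p.1.2

/-- `ĥμ^q(U) = inf_{δ>0} ĥμ^q_δ(U)` for `U` open. -/
noncomputable def packOpen {X : Type*} [MetricSpace X] (q : X → ℝ → ℝ≥0∞)
    (U : Set X) : ℝ≥0∞ :=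
  ⨅ (δ : ℝ) (_ : 0 < δ), packPre q δ U

/-- The packing construction extended to arbitrary sets:
`ĥμ^q(A) = inf { ĥμ^q(U) : A ⊆ U, U open }`. -/
noncomputable def packM {X : Type*} [MetricSpace X] (q : X → ℝ → ℝ≥0∞)
    (A : Set X) : ℝ≥0∞ :=
  ⨅ (U : Set X) (_ : IsOpen U) (_ : A ⊆ U), packOpen q U

/-- A set of diameter less than `ξ` in a directionally `(ξ,η,ζ)`-limited space has the
Besicovitch covering property. -/
theorem DirLimited.hasBesicovitchCovering {X : Type*} [MetricSpace X] {ξ η : ℝ} {ζ : ℕ}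
    (hη' : η ≤ 1 / 3) (hdir : DirLimited (Set.univ : Set X) ξ η ζ) {V : Set X}
    (hV : ∀ a ∈ V, ∀ b ∈ V, dist a b < ξ) : HasBesicovitchCovering V := by
  refine ⟨21 * ζ + 1, 11 / 10, by norm_num, ⟨fun S => ?_⟩⟩
  set N := 21 * ζ + 1 with hN
  let a : X := S.c (Fin.last N)
  let R : ℝ := S.r (Fin.last N)
  let c : Fin N → X := fun i => S.c i.castSucc
  let r : Fin N → ℝ := fun i => S.r i.castSucc
  have hR : 0 < R := S.rpos _
  have hr : ∀ i, 0 < r i := fun i => S.rpos _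
  have hlast : ∀ i, r i ≤ dist a (c i) ∧ R ≤ 11 / 10 * r i := fun i => by
    have := S.hlast i.castSucc (Fin.castSucc_lt_last i)
    rw [dist_comm] at this
    exact this
  have hinter : ∀ i, dist a (c i) ≤ r i + R := fun i => by
    have := S.inter i.castSucc (Fin.castSucc_lt_last i)
    rw [dist_comm] at this
    exact this
  have hsep : ∀ i j, i ≠ j → r i ≤ dist (c i) (c j) ∧ r j ≤ 11 / 10 * r i ∨
      r j ≤ dist (c i) (c j) ∧ r i ≤ 11 / 10 * r j := fun i j hij => by
    have := S.h (i := i.castSucc) (j := j.castSucc)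
      (fun h => hij (Fin.castSucc_injective _ h))
    beta_reduce at this
    rw [dist_comm (S.c j.castSucc)] at this
    exact this
  have hcinj : Function.Injective c := by
    intro i j hij
    by_contra hne
    have h1 := hr i
    have h2 := hr j
    rcases hsep i j hne with h | h <;> rw [hij, dist_self] at h <;> linarith [h.1]
  let g : Fin N → Fin 21 := fun i => ⟨min ⌊10 * dist a (c i) / R⌋₊ 20, by omega⟩
  obtain ⟨k, hk⟩ : ∃ k, ζ < (Finset.univ.filter fun i => g i = k).card := by
    apply Fintype.exists_lt_card_fiber_of_mul_lt_card
    simp [hN]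
  let B : Set X := c '' {i | g i = k}
  have hB : B.ncard = (Finset.univ.filter fun i => g i = k).card := by
    rw [Set.ncard_image_of_injective _ hcinj, ← Set.ncard_coe_finset]
    simp
  have key := (hdir a (mem_univ _) B ?_ ?_).2
  · omega
  · rintro _ ⟨i, -, rfl⟩
    refine ⟨mem_univ _, ?_, ?_⟩
    · rw [Metric.mem_ball]
      exact hV _ (Subtype.coe_prop _) _ (Subtype.coe_prop _)
    · intro h
      have := (hlast i).1
      rw [Set.mem_singleton_iff.1 h, dist_self] at this
      linarith [hr i]
  · rintro _ ⟨i, hi, rfl⟩ _ ⟨j, hj, rfl⟩ hne hle x hx1 hx2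
    have hij : i ≠ j := fun h => hne (h ▸ rfl)
    have hli := hlast i
    have hlj := hlast j
    have hii := hinter i
    have hri := hr i
    have hrj := hr j
    have htri : dist (c i) (c j) ≤ dist x (c i) + dist x (c j) := dist_triangle_left _ _ _
    have hpos : 0 < dist a (c j) := by linarith
    rw [le_div_iff₀ hpos]
    have hη3 : η * dist a (c j) ≤ 1 / 3 * dist a (c j) :=
      mul_le_mul_of_nonneg_right hη' hpos.le
    have hg : min ⌊10 * dist a (c i) / R⌋₊ 20 = min ⌊10 * dist a (c j) / R⌋₊ 20 := by
      have : g i = g j := hi.trans hj.symm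
      simpa [g] using this
    by_cases hfar : 20 ≤ ⌊10 * dist a (c j) / R⌋₊
    · have h2 : (20 : ℝ) ≤ 10 * dist a (c j) / R := by
        exact_mod_cast (Nat.le_floor_iff (by positivity)).1 hfar
      rw [le_div_iff₀ hR] at h2
      rcases hsep i j hij with h | h <;> linarith [h.1, h.2]
    · have hfl : ⌊10 * dist a (c i) / R⌋₊ = ⌊10 * dist a (c j) / R⌋₊ := by omega
      have h2 : 10 * dist a (c j) / R < 20 := by
        exact_mod_cast (Nat.floor_lt (by positivity)).1 (not_le.1 hfar)
      have h3 : 10 * dist a (c i) / R < 10 * dist a (c j) / R + 1 := by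
        have h4 := Nat.lt_floor_add_one (10 * dist a (c i) / R)
        have h5 := Nat.floor_le (a := 10 * dist a (c j) / R) (by positivity)
        rw [hfl] at h4
        linarith
      rw [div_lt_iff₀ hR] at h2
      rw [div_add_one hR.ne', div_lt_div_iff_of_pos_right hR] at h3
      rcases hsep i j hij with h | h <;> linarith [h.1, h.2]

/-- If `ν` is asymptotically bounded along scaling by `α` with constant `b` at `x`, and the ratio
`ν(B_r(x)) / μ(B_r(x))` has a finite limit, then `μ(B_r(x)) ≤ c μ(B_{αr}(x))` for arbitrarily
small `r`, for every `c > b`. -/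
theorem frequently_measure_closedBall_le {Y : Type*} [MetricSpace Y] [MeasurableSpace Y]
    (μ ν : Measure Y) [IsFiniteMeasure μ] [IsFiniteMeasure ν] {α b c : ℝ} (hα : 0 < α)
    (hα1 : α ≤ 1) (hb : 1 ≤ b) (hbc : b < c) (x : Y)
    (hpos : ∀ r, 0 < r → 0 < ν (closedBall x r))
    (hν : ∀ᶠ r in 𝓝[>] (0 : ℝ),
      ν (closedBall x r) ≤ ENNReal.ofReal b * ν (closedBall x (α * r)))
    {L : ℝ≥0∞} (hL : L < ⊤)
    (hlim : Tendsto (fun r => ν (closedBall x r) / μ (closedBall x r)) (𝓝[>] (0 : ℝ)) (𝓝 L)) :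
    ∃ᶠ r in 𝓝[>] (0 : ℝ),
      μ (closedBall x r) ≤ ENNReal.ofReal c * μ (closedBall x (α * r)) := by
  rcases hα1.eq_or_lt with rfl | hα1
  · refine (Eventually.of_forall fun r => ?_).frequently
    rw [one_mul]
    exact le_mul_of_one_le_left' (by simpa using hb.trans hbc.le)
  intro hbad
  obtain ⟨M, hLM, hM⟩ := exists_between hL
  have hlt := hlim.eventually (gt_mem_nhds hLM)
  obtain ⟨ρ, hρ, hρs⟩ := mem_nhdsGT_iff_exists_Ioc_subset.1 ((hbad.and hν).and hlt)
  rw [Set.mem_Ioi] at hρ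
  have hmem : ∀ k : ℕ, α ^ k * ρ ∈ Ioc 0 ρ := fun k =>
    ⟨by positivity, mul_le_of_le_one_left hρ.le (pow_le_one₀ hα.le hα1.le)⟩
  have hc0 : 0 < c := by linarith
  have hb0 : 0 < b := by linarith
  have h1 : ∀ k : ℕ, c ^ k * μ.real (closedBall x (α ^ k * ρ)) ≤ μ.real (closedBall x ρ) := by
    intro k
    induction k with
    | zero => simp
    | succ k ih =>
      have h := (hρs (hmem k)).1.1
      rw [not_le] at h
      have h' := ENNReal.toReal_mono (measure_ne_top μ _) h.le
      rw [ENNReal.toReal_mul, ENNReal.toReal_ofReal hc0.le] at h'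
      calc c ^ (k + 1) * μ.real (closedBall x (α ^ (k + 1) * ρ))
          = c ^ k * (c * μ.real (closedBall x (α * (α ^ k * ρ)))) := by ring_nf
        _ ≤ c ^ k * μ.real (closedBall x (α ^ k * ρ)) := by
            gcongr
            exact h'
        _ ≤ _ := ih
  have h2 : ∀ k : ℕ, ν.real (closedBall x ρ) ≤ b ^ k * ν.real (closedBall x (α ^ k * ρ)) := by
    intro k
    induction k with
    | zero => simp
    | succ k ih =>
      have h := (hρs (hmem k)).1.2
      have h' := ENNReal.toReal_mono (ENNReal.mul_ne_top ofReal_ne_top (measure_ne_top ν _)) h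
      rw [ENNReal.toReal_mul, ENNReal.toReal_ofReal hb0.le] at h'
      calc ν.real (closedBall x ρ) ≤ b ^ k * ν.real (closedBall x (α ^ k * ρ)) := ih
        _ ≤ b ^ k * (b * ν.real (closedBall x (α * (α ^ k * ρ)))) := by
            gcongr
            exact h'
        _ = _ := by ring_nf
  have h3 : ∀ k : ℕ, ν.real (closedBall x (α ^ k * ρ)) ≤
      M.toReal * μ.real (closedBall x (α ^ k * ρ)) := by
    intro k
    have h := (hρs (hmem k)).2
    have hν0 := (hpos _ (hmem k).1).ne'
    have h' := (ENNReal.div_le_iff_le_mul (Or.inr hM.ne) (Or.inl (measure_ne_top μ _))).1 h.le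
    have h'' := ENNReal.toReal_mono (ENNReal.mul_ne_top hM.ne (measure_ne_top μ _)) h'
    rwa [ENNReal.toReal_mul] at h''
  have hνρ : 0 < ν.real (closedBall x ρ) :=
    ENNReal.toReal_pos (hpos ρ hρ).ne' (measure_ne_top ν _)
  have h4 : ∀ k : ℕ, (c / b) ^ k ≤
      M.toReal * μ.real (closedBall x ρ) / ν.real (closedBall x ρ) := by
    intro k
    rw [le_div_iff₀ hνρ, div_pow, div_mul_eq_mul_div, div_le_iff₀ (by positivity)]
    calc c ^ k * ν.real (closedBall x ρ)
        ≤ c ^ k * (b ^ k * (M.toReal * μ.real (closedBall x (α ^ k * ρ)))) := by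
          gcongr
          exact (h2 k).trans (by gcongr; exact h3 k)
      _ = b ^ k * M.toReal * (c ^ k * μ.real (closedBall x (α ^ k * ρ))) := by ring
      _ ≤ b ^ k * M.toReal * μ.real (closedBall x ρ) := by
          gcongr
          exact h1 k
      _ = _ := by ring
  obtain ⟨k, hk⟩ := pow_unbounded_of_one_lt
    (M.toReal * μ.real (closedBall x ρ) / ν.real (closedBall x ρ)) ((one_lt_div hb0).2 hbc)
  exact (hk.trans_le (h4 k)).false

theorem Subtype.image_closedBall_of_subset {X : Type*} [MetricSpace X] {V : Set X} (x : V)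
    {s : ℝ} (h : closedBall (x : X) s ⊆ V) :
    ((↑) : V → X) '' closedBall x s = closedBall (x : X) s := by
  ext y
  constructor
  · rintro ⟨z, hz, rfl⟩
    exact hz
  · intro hy
    exact ⟨⟨y, h hy⟩, hy, rfl⟩

/-- A small open set of finite measure has a packing, consisting of balls of small radius, which
carries a fixed proportion of its measure. -/
theorem exists_isPackingOf_measure_le_of_small {X : Type*} [MetricSpace X] [MeasurableSpace X]
    [BorelSpace X] [SecondCountableTopology X] {ξ η : ℝ} {ζ : ℕ} (hη' : η ≤ 1 / 3)
    (hdir : DirLimited (Set.univ : Set X) ξ η ζ) (ν : Measure X) {α γ : ℝ} (hα : 0 < α)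
    (hα1 : α ≤ 1) (hγ : 1 ≤ γ) (hν : AsympBounded ν α γ) (μ : Measure X) {c : ℝ} (hc : γ < c)
    {V : Set X} (hVo : IsOpen V) (hV : ∀ a ∈ V, ∀ b ∈ V, dist a b < ξ) (hμV : μ V < ⊤) {δ : ℝ}
    (hδ : 0 < δ) :
    ∃ P, IsPackingOf V δ P ∧
      μ V ≤ ENNReal.ofReal c * ∑' p : P, μ (closedBall p.1.1 (α * p.1.2)) := by
  have := hdir.hasBesicovitchCovering hη' hV
  have hVm : MeasurableSet V := hVo.measurableSet
  set i : V → X := (↑) with hi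
  have hνV : ν V < ⊤ := hν.1 V (isBounded_iff.2 ⟨ξ, fun a ha b hb => (hV a ha b hb).le⟩)
  have happ : ∀ (m : Measure X) (s : Set V), m.comap i s = m (i '' s) := fun m s =>
    comap_subtype_coe_apply hVm m s
  have hfinμ : IsFiniteMeasure (μ.comap i) := ⟨by rw [happ]; simpa [hi] using hμV⟩
  have hfinν : IsFiniteMeasure (ν.comap i) := ⟨by rw [happ]; simpa [hi] using hνV⟩
  have hball : ∀ x : V, ∃ ρ > 0, closedBall (x : X) ρ ⊆ V := fun x =>
    nhds_basis_closedBall.mem_iff.1 (hVo.mem_nhds x.2)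
  choose ρ hρ hρV using hball
  have hcb : ∀ (m : Measure X) (x : V) (s : ℝ), s ≤ ρ x →
      m.comap i (closedBall x s) = m (closedBall (x : X) s) := fun m x s hs => by
    rw [happ, Subtype.image_closedBall_of_subset x ((closedBall_subset_closedBall hs).trans (hρV x))]
  have hαs : ∀ s : ℝ, 0 < s → α * s ≤ s := fun s hs => mul_le_of_le_one_left hs.le hα1
  have hsmall : ∀ x : V, ∀ᶠ s in 𝓝[>] (0 : ℝ), 0 < s ∧ s < ρ x := fun x =>
    Ioo_mem_nhdsGT (hρ x)
  obtain ⟨b, hγb, hbc⟩ := exists_between hc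
  let f : V → Set ℝ := fun x =>
    {s | μ.comap i (closedBall x s) ≤ ENNReal.ofReal c * μ.comap i (closedBall x (α * s))}
  have hae : ∀ᵐ x ∂(μ.comap i), ∃ᶠ s in 𝓝[>] (0 : ℝ), s ∈ f x := by
    filter_upwards [Besicovitch.ae_tendsto_rnDeriv (ν.comap i) (μ.comap i),
      Measure.rnDeriv_lt_top (ν.comap i) (μ.comap i)] with x hx hx'
    refine frequently_measure_closedBall_le (μ.comap i) (ν.comap i) hα hα1
      (hγ.trans hγb.le) hbc x (fun s hs => ?_) ?_ hx' hx
    · have hmin : 0 < min s (ρ x) := lt_min hs (hρ x)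
      refine lt_of_lt_of_le ?_ (measure_mono (closedBall_subset_closedBall (min_le_left s (ρ x))))
      rw [hcb ν x _ (min_le_right _ _)]
      exact hν.2.1 x _ hmin
    · have hlt : limsup (fun r : ℝ => ν (closedBall (x : X) r) / ν (closedBall (x : X) (α * r)))
          (𝓝[>] 0) < ENNReal.ofReal b :=
        (hν.2.2 x).trans_lt ((ENNReal.ofReal_lt_ofReal_iff (by linarith)).2 hγb)
      filter_upwards [eventually_lt_of_limsup_lt hlt, hsmall x] with s hs hs'
      rw [hcb ν x _ hs'.2.le, hcb ν x _ ((hαs s hs'.1).trans hs'.2.le)]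
      exact (ENNReal.div_le_iff_le_mul (Or.inr ofReal_ne_top)
        (Or.inl (hν.1 _ isBounded_closedBall).ne)).1 hs.le
  obtain ⟨t, r, htc, hts, hr, hμt, hdisj⟩ :=
    Besicovitch.exists_disjoint_closedBall_covering_ae (μ.comap i) f
      {x | ∃ᶠ s in 𝓝[>] (0 : ℝ), s ∈ f x}
      (fun x hx ε hε => (hx.and_eventually (Ioo_mem_nhdsGT hε)).exists)
      (fun x => min δ (ρ x)) (fun x _ => lt_min hδ (hρ x))
  let e : V → X × ℝ := fun x => (x, r x)
  have he : Function.Injective e := fun x y h => Subtype.ext (congrArg Prod.fst h)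
  have hrρ : ∀ x ∈ t, r x ≤ ρ x := fun x hx => (hr x hx).2.2.le.trans (min_le_right _ _)
  have hsub : ∀ x ∈ t, closedBall (x : X) (r x) ⊆ V := fun x hx =>
    (closedBall_subset_closedBall (hrρ x hx)).trans (hρV x)
  refine ⟨e '' t, ⟨htc.image _, ?_, ?_⟩, ?_⟩
  · rintro _ ⟨x, hx, rfl⟩
    exact ⟨(hr x hx).2.1, (hr x hx).2.2.le.trans (min_le_left _ _), hsub x hx⟩
  · rintro _ ⟨x, hx, rfl⟩ _ ⟨y, hy, rfl⟩ hxy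
    have h := hdisj hx hy (fun h => hxy (h ▸ rfl))
    change Disjoint (closedBall (x : X) (r x)) (closedBall (y : X) (r y))
    rw [← Subtype.image_closedBall_of_subset x (hsub x hx),
      ← Subtype.image_closedBall_of_subset y (hsub y hy)]
    exact (disjoint_image_iff Subtype.coe_injective).2 h
  · have := htc.to_subtype
    rw [tsum_image (fun p : X × ℝ => μ (closedBall p.1 (α * p.2))) he.injOn]
    calc μ V = μ.comap i univ := by rw [happ]; simp [hi]
      _ ≤ μ.comap i ((⋃ x ∈ t, closedBall x (r x)) ∪
            (({x | ∃ᶠ s in 𝓝[>] (0 : ℝ), s ∈ f x} \ ⋃ x ∈ t, closedBall x (r x)) ∪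
              {x | ∃ᶠ s in 𝓝[>] (0 : ℝ), s ∈ f x}ᶜ)) := by
          apply measure_mono
          intro x _
          by_cases h1 : x ∈ ⋃ x ∈ t, closedBall x (r x)
          · exact Or.inl h1
          · by_cases h2 : x ∈ {x | ∃ᶠ s in 𝓝[>] (0 : ℝ), s ∈ f x}
            · exact Or.inr (Or.inl ⟨h2, h1⟩)
            · exact Or.inr (Or.inr h2)
      _ ≤ μ.comap i (⋃ x ∈ t, closedBall x (r x)) + (0 + 0) := by
          refine (measure_union_le _ _).trans (add_le_add_right ((measure_union_le _ _).trans ?_) _)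
          exact add_le_add hμt.le (ae_iff.1 hae).le
      _ ≤ ∑' x : t, μ.comap i (closedBall (x : V) (r x)) := by
          rw [add_zero, add_zero]
          exact measure_biUnion_le _ htc _
      _ ≤ ∑' x : t, ENNReal.ofReal c * μ (closedBall (x : X) (α * r x)) := by
          refine ENNReal.tsum_le_tsum fun x => ?_
          have h := (hr x x.2).1
          simp only [f, mem_ofPred_eq] at h
          rwa [hcb μ x (α * r x) ((hαs _ (hr x x.2).2.1).trans (hrρ x x.2))] at h
      _ = _ := ENNReal.tsum_mul_left

theorem exists_ball_null_frontier {X : Type*} [MetricSpace X] [MeasurableSpace X] [BorelSpace X]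
    (μ : Measure X) (x : X) {R : ℝ} (hR : 0 < R) (hμ : μ (ball x R) < ⊤) :
    ∃ ρ, 0 < ρ ∧ ρ < R ∧ μ (frontier (ball x ρ)) = 0 := by
  have : IsFiniteMeasure (μ.restrict (ball x R)) := isFiniteMeasure_restrict.2 hμ.ne
  obtain ⟨ρ, hρ, h0⟩ := exists_null_frontier_thickening (μ.restrict (ball x R)) {x} hR
  refine ⟨ρ, hρ.1, hρ.2, ?_⟩
  rw [thickening_singleton] at h0
  rwa [Measure.restrict_apply isClosed_frontier.measurableSet, inter_eq_left.2] at h0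
  exact frontier_ball_subset_sphere.trans
    (sphere_subset_closedBall.trans (closedBall_subset_ball hρ.2))

/-- An open set on which `μ` is locally finite has a packing by balls of small radius, which
carries a fixed proportion of its measure. -/
theorem exists_isPackingOf_measure_le {X : Type*} [MetricSpace X] [MeasurableSpace X]
    [BorelSpace X] [SecondCountableTopology X] {ξ η : ℝ} {ζ : ℕ} (hξ : 0 < ξ) (hη' : η ≤ 1 / 3)
    (hdir : DirLimited (Set.univ : Set X) ξ η ζ) (ν : Measure X) {α γ : ℝ} (hα : 0 < α)
    (hα1 : α ≤ 1) (hγ : 1 ≤ γ) (hν : AsympBounded ν α γ) (μ : Measure X) {c : ℝ} (hc : γ < c)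
    {U : Set X} (hUo : IsOpen U) (hμU : ∀ x ∈ U, ∃ r > 0, μ (ball x r) < ⊤) {δ : ℝ}
    (hδ : 0 < δ) :
    ∃ P, IsPackingOf U δ P ∧
      μ U ≤ ENNReal.ofReal c * ∑' p : P, μ (closedBall p.1.1 (α * p.1.2)) := by
  rcases U.eq_empty_or_nonempty with rfl | hne
  · exact ⟨∅, ⟨countable_empty, by simp, by simp⟩, by simp⟩
  have hex : ∀ x : X, ∃ ρ, x ∈ U → 0 < ρ ∧ ρ < ξ / 2 ∧ ball x ρ ⊆ U ∧ μ (ball x ρ) < ⊤ ∧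
      μ (frontier (ball x ρ)) = 0 := by
    intro x
    by_cases hx : x ∈ U
    · obtain ⟨r, hr, hμr⟩ := hμU x hx
      obtain ⟨s, hs, hsU⟩ := Metric.isOpen_iff.1 hUo x hx
      have hR : 0 < min r (min s (ξ / 2)) := by positivity
      obtain ⟨ρ, h0, hρ, hfr⟩ := exists_ball_null_frontier μ x hR
        ((measure_mono (ball_subset_ball (min_le_left _ _))).trans_lt hμr)
      rw [lt_min_iff, lt_min_iff] at hρ
      exact ⟨ρ, fun _ => ⟨h0, hρ.2.2, (ball_subset_ball hρ.2.1.le).trans hsU,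
        (measure_mono (ball_subset_ball hρ.1.le)).trans_lt hμr, hfr⟩⟩
    · exact ⟨0, fun h => (hx h).elim⟩
  choose ρ hρ using hex
  obtain ⟨t, htU, htc, hUt⟩ := TopologicalSpace.countable_cover_nhdsWithin
    (f := fun x => ball x (ρ x)) (s := U)
    (fun x hx => mem_nhdsWithin_of_mem_nhds (ball_mem_nhds x (hρ x hx).1))
  have htne : t.Nonempty := by
    obtain ⟨x, hx⟩ := hne
    obtain ⟨y, hy, -⟩ := mem_iUnion₂.1 (hUt hx)
    exact ⟨y, hy⟩
  obtain ⟨u, rfl⟩ := htc.exists_eq_range htne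
  have hu : ∀ n, u n ∈ U := fun n => htU (mem_range_self n)
  let S : ℕ → Set X := fun n => ball (u n) (ρ (u n))
  let V : ℕ → Set X := fun n => S n \ ⋃ j ∈ Iio n, closure (S j)
  have hVS : ∀ n, V n ⊆ S n := fun n => sdiff_subset
  have hVo : ∀ n, IsOpen (V n) := fun n =>
    isOpen_ball.sdiff ((finite_Iio n).isClosed_biUnion fun _ _ => isClosed_closure)
  have hVlt : ∀ m n, m < n → Disjoint (V m) (V n) := fun m n hmn =>
    Set.disjoint_left.2 fun x hm hn =>
      hn.2 (mem_iUnion₂.2 ⟨m, hmn, subset_closure (hVS m hm)⟩)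
  have hVd : ∀ m n, m ≠ n → Disjoint (V m) (V n) := fun m n hmn =>
    hmn.lt_or_gt.elim (hVlt m n) fun h => (hVlt n m h).symm
  have hcover : U ⊆ (⋃ n, V n) ∪ ⋃ n, frontier (S n) := by
    intro x hx
    have hS : ∃ n, x ∈ closure (S n) := by
      obtain ⟨_, ⟨n, rfl⟩, hn⟩ := mem_iUnion₂.1 (hUt hx)
      exact ⟨n, subset_closure hn⟩
    classical
    by_cases hmem : x ∈ S (Nat.find hS)
    · refine Or.inl (mem_iUnion.2 ⟨Nat.find hS, hmem, fun h => ?_⟩)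
      obtain ⟨j, hj, hxj⟩ := mem_iUnion₂.1 h
      exact Nat.find_min hS hj hxj
    · refine Or.inr (mem_iUnion.2 ⟨Nat.find hS, Nat.find_spec hS, ?_⟩)
      rwa [isOpen_ball.interior_eq]
  have hloc : ∀ n, ∃ P, IsPackingOf (V n) δ P ∧
      μ (V n) ≤ ENNReal.ofReal c * ∑' p : P, μ (closedBall p.1.1 (α * p.1.2)) := fun n => by
    refine exists_isPackingOf_measure_le_of_small hη' hdir ν hα hα1 hγ hν μ hc (hVo n) ?_
      ((measure_mono (hVS n)).trans_lt (hρ _ (hu n)).2.2.2.1) hδ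
    intro a ha b hb
    have h1 := mem_ball.1 (hVS n ha)
    have h2 := mem_ball.1 (hVS n hb)
    have h3 := dist_triangle_right a b (u n)
    linarith [(hρ _ (hu n)).2.1]
  choose P hP hμP using hloc
  have hdisj : ∀ m n, m ≠ n → ∀ p ∈ P m, ∀ p' ∈ P n,
      Disjoint (closedBall p.1 p.2) (closedBall p'.1 p'.2) := fun m n hmn p hp p' hp' =>
    (hVd m n hmn).mono ((hP m).2.1 p hp).2.2 ((hP n).2.1 p' hp').2.2
  refine ⟨⋃ n, P n, ⟨countable_iUnion fun n => (hP n).1, ?_, ?_⟩, ?_⟩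
  · intro p hp
    obtain ⟨n, hn⟩ := mem_iUnion.1 hp
    have h := (hP n).2.1 p hn
    exact ⟨h.1, h.2.1, h.2.2.trans ((hVS n).trans (hρ _ (hu n)).2.2.1)⟩
  · intro p hp p' hp' hne
    obtain ⟨m, hm⟩ := mem_iUnion.1 hp
    obtain ⟨n, hn⟩ := mem_iUnion.1 hp'
    rcases eq_or_ne m n with rfl | hmn
    · exact (hP m).2.2 hm hn hne
    · exact hdisj m n hmn p hm p' hn
  · have hPd : Pairwise (Function.onFun Disjoint P) := fun m n hmn =>
      Set.disjoint_left.2 fun p hm hn =>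
        Set.disjoint_left.1 (hdisj m n hmn p hm p hn)
          (mem_closedBall_self ((hP m).2.1 p hm).1.le)
          (mem_closedBall_self ((hP m).2.1 p hm).1.le)
    have hsum : ∑' p : ⋃ n, P n, μ (closedBall p.1.1 (α * p.1.2)) =
        ∑' n, ∑' p : P n, μ (closedBall p.1.1 (α * p.1.2)) := by
      rw [← ENNReal.tsum_sigma]
      exact ((Set.unionEqSigmaOfDisjoint hPd).symm.tsum_eq _).symm
    rw [hsum, ← ENNReal.tsum_mul_left]
    calc μ U ≤ μ (⋃ n, V n) + μ (⋃ n, frontier (S n)) :=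
          (measure_mono hcover).trans (measure_union_le _ _)
      _ = μ (⋃ n, V n) := by
          rw [measure_iUnion_null fun n => (hρ _ (hu n)).2.2.2.2, add_zero]
      _ ≤ ∑' n, μ (V n) := measure_iUnion_le _
      _ ≤ _ := ENNReal.tsum_le_tsum hμP

theorem le_packPre {X : Type*} [MetricSpace X] (q : X → ℝ → ℝ≥0∞) {δ ε : ℝ} {U : Set X}
    {P : Set (X × ℝ)} (hP : IsPackingOf U ε P) (h : ε ≤ δ) :
    ∑' p : P, q p.1.1 p.1.2 ≤ packPre q δ U :=
  le_iSup₂_of_le P ⟨hP.1, fun p hp =>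
    ⟨(hP.2.1 p hp).1, (hP.2.1 p hp).2.1.trans h, (hP.2.1 p hp).2.2⟩, hP.2.2⟩ le_rfl

theorem packOpen_le {X : Type*} [MetricSpace X] [MeasurableSpace X] [BorelSpace X]
    (μ : Measure X) (q : X → ℝ → ℝ≥0∞) {C r₀ : ℝ} (hr₀ : 0 < r₀)
    (hq₂ : ∀ (x : X) (r : ℝ), 0 < r → r < r₀ →
      q x r ≤ ENNReal.ofReal C * μ (closedBall x r)) (U : Set X) :
    packOpen q U ≤ ENNReal.ofReal C * μ U := by
  refine (iInf₂_le (r₀ / 2) (by positivity)).trans (iSup₂_le fun P hP => ?_)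
  calc ∑' p : P, q p.1.1 p.1.2
      ≤ ∑' p : P, ENNReal.ofReal C * μ (closedBall p.1.1 p.1.2) :=
        ENNReal.tsum_le_tsum fun p => by
          have h := hP.2.1 p p.2
          exact hq₂ _ _ h.1 (by linarith [h.2.1])
    _ = ENNReal.ofReal C * ∑' p : P, μ (closedBall p.1.1 p.1.2) := ENNReal.tsum_mul_left
    _ ≤ ENNReal.ofReal C * μ U := by
        gcongr
        have := hP.1.to_subtype
        rw [← measure_iUnion (fun p p' hpp' => hP.2.2 p.2 p'.2 fun h => hpp' (Subtype.ext h))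
          fun p => isClosed_closedBall.measurableSet]
        exact measure_mono (iUnion_subset fun p => (hP.2.1 p p.2).2.2)

theorem measure_le_packPre {X : Type*} [MetricSpace X] [MeasurableSpace X]
    [BorelSpace X] [SecondCountableTopology X] {ξ η : ℝ} {ζ : ℕ} (hξ : 0 < ξ) (hη' : η ≤ 1 / 3)
    (hdir : DirLimited (Set.univ : Set X) ξ η ζ) (ν : Measure X) {α γ : ℝ} (hα : 0 < α)
    (hα1 : α ≤ 1) (hγ : 1 ≤ γ) (hν : AsympBounded ν α γ) (μ : Measure X)
    (q : X → ℝ → ℝ≥0∞) {C r₀ : ℝ} (hC : 1 ≤ C) (hr₀ : 0 < r₀)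
    (hq₁ : ∀ (x : X) (r : ℝ), 0 < r → r < r₀ →
      ENNReal.ofReal (1 / C) * μ (closedBall x (α * r)) ≤ q x r)
    {U : Set X} (hUo : IsOpen U) {δ : ℝ} (hδ : 0 < δ) :
    ENNReal.ofReal (1 / (γ * C)) * μ U ≤ packPre q δ U := by
  have hC0 : 0 < C := by linarith
  by_cases hfin : ∀ x ∈ U, ∃ r > 0, μ (ball x r) < ⊤
  · have hbound : ∀ c, γ < c → ENNReal.ofReal (1 / (c * C)) * μ U ≤ packPre q δ U := by
      intro c hc
      have hc0 : 0 < c := by linarith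
      obtain ⟨P, hP, hμP⟩ := exists_isPackingOf_measure_le hξ hη' hdir ν hα hα1 hγ hν μ hc hUo
        hfin (lt_min hδ (half_pos hr₀))
      calc ENNReal.ofReal (1 / (c * C)) * μ U
          ≤ ENNReal.ofReal (1 / (c * C)) *
            (ENNReal.ofReal c * ∑' p : P, μ (closedBall p.1.1 (α * p.1.2))) := by gcongr
        _ = ENNReal.ofReal (1 / C) * ∑' p : P, μ (closedBall p.1.1 (α * p.1.2)) := by
            rw [← mul_assoc, ← ENNReal.ofReal_mul (by positivity)]
            congr 2
            field_simp
        _ = ∑' p : P, ENNReal.ofReal (1 / C) * μ (closedBall p.1.1 (α * p.1.2)) :=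
            ENNReal.tsum_mul_left.symm
        _ ≤ ∑' p : P, q p.1.1 p.1.2 := ENNReal.tsum_le_tsum fun p => by
            have h := hP.2.1 p p.2
            exact hq₁ _ _ h.1 (by linarith [h.2.1.trans (min_le_right _ _)])
        _ ≤ packPre q δ U := le_packPre q hP (min_le_left _ _)
    have hγC : γ * C ≠ 0 := by positivity
    have hlim : Tendsto (fun c : ℝ => ENNReal.ofReal (1 / (c * C)) * μ U) (𝓝[>] γ)
        (𝓝 (ENNReal.ofReal (1 / (γ * C)) * μ U)) := by
      refine ENNReal.Tendsto.mul_const (ENNReal.tendsto_ofReal ?_) (Or.inl ?_)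
      · have hcont : ContinuousAt (fun c : ℝ => 1 / (c * C)) γ :=
          continuousAt_const.div (continuousAt_id.mul continuousAt_const) hγC
        exact hcont.tendsto.mono_left nhdsWithin_le_nhds
      · have : 0 < 1 / (γ * C) := by positivity
        exact (ENNReal.ofReal_pos.2 this).ne'
    exact le_of_tendsto hlim (eventually_mem_nhdsWithin.mono fun c hc => hbound c hc)
  · push Not at hfin
    obtain ⟨x, hx, hinf⟩ := hfin
    obtain ⟨s, hs, hsU⟩ := nhds_basis_closedBall.mem_iff.1 (hUo.mem_nhds hx)
    set ρ := min s (min δ (r₀ / 2)) with hρ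
    have hρ0 : 0 < ρ := by positivity
    have hρs : ρ ≤ s := min_le_left _ _
    have hρδ : ρ ≤ δ := (min_le_right _ _).trans (min_le_left _ _)
    have hρr : ρ ≤ r₀ / 2 := (min_le_right _ _).trans (min_le_right _ _)
    have hP : IsPackingOf U δ {(x, ρ)} := by
      refine ⟨countable_singleton _, ?_, pairwise_singleton _ _⟩
      rintro _ rfl
      exact ⟨hρ0, hρδ, (closedBall_subset_closedBall hρs).trans hsU⟩
    have hle := le_packPre q hP le_rfl
    rw [tsum_singleton (x, ρ) fun p : X × ℝ => q p.1 p.2] at hle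
    have hq := hq₁ x ρ hρ0 (by linarith)
    have htop : μ (closedBall x (α * ρ)) = ⊤ :=
      top_le_iff.1 ((hinf (α * ρ) (by positivity)).trans (measure_mono ball_subset_closedBall))
    have hCpos : ENNReal.ofReal (1 / C) ≠ 0 :=
      (ENNReal.ofReal_pos.2 (by positivity)).ne'
    rw [htop, ENNReal.mul_top hCpos] at hq
    exact le_top.trans (hq.trans hle)

/-- under Hypothesis 1 (directionally limited, asymptotically `(α,γ)`-bounded
`ν`) and the two-sided bound `C⁻¹ μ(B_{αr}(x)) ≤ q(B_r(x)) ≤ C μ(B_r(x))` for `0 < r < r₀`,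
the packing construction satisfies
`(1/(γC)) μ(A) ≤ ĥμ^q(A) ≤ C inf{μ(U) : A ⊆ U open}` for every Borel `A`; if `μ` is outer
regular then `(1/(γC)) μ(A) ≤ ĥμ^q(A) ≤ C μ(A)`. -/
theorem stmt14 {X : Type*} [MetricSpace X] [MeasurableSpace X] [BorelSpace X]
    [TopologicalSpace.SeparableSpace X]
    (ξ η : ℝ) (ζ : ℕ) (hξ : 0 < ξ) (hη : 0 < η) (hη' : η ≤ 1/3) (hζ : 0 < ζ)
    (hdir : DirLimited (Set.univ : Set X) ξ η ζ)
    (ν : Measure X) (α γ : ℝ) (hα : 0 < α) (hα1 : α ≤ 1) (hγ : 1 ≤ γ)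
    (hν : AsympBounded ν α γ)
    (μ : Measure X) (q : X → ℝ → ℝ≥0∞) (C r₀ : ℝ) (hC : 1 ≤ C) (hr₀ : 0 < r₀)
    (hq₁ : ∀ (x : X) (r : ℝ), 0 < r → r < r₀ →
      ENNReal.ofReal (1 / C) * μ (Metric.closedBall x (α * r)) ≤ q x r)
    (hq₂ : ∀ (x : X) (r : ℝ), 0 < r → r < r₀ →
      q x r ≤ ENNReal.ofReal C * μ (Metric.closedBall x r)) :
    (∀ A : Set X, MeasurableSet A →
      ENNReal.ofReal (1 / (γ * C)) * μ A ≤ packM q A ∧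
      packM q A ≤ ENNReal.ofReal C * ⨅ (U : Set X) (_ : IsOpen U) (_ : A ⊆ U), μ U) ∧
    (μ.OuterRegular → ∀ A : Set X, MeasurableSet A →
      ENNReal.ofReal (1 / (γ * C)) * μ A ≤ packM q A ∧
      packM q A ≤ ENNReal.ofReal C * μ A) := by
  have : SecondCountableTopology X := UniformSpace.secondCountable_of_separable X
  have hlower : ∀ A : Set X, ENNReal.ofReal (1 / (γ * C)) * μ A ≤ packM q A := fun A =>
    le_iInf fun U => le_iInf fun hU => le_iInf fun hAU => le_iInf₂ fun δ hδ =>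
      le_trans (by gcongr) (measure_le_packPre hξ hη' hdir ν hα hα1 hγ hν μ q hC hr₀ hq₁ hU hδ)
  have hupper : ∀ A : Set X,
      packM q A ≤ ENNReal.ofReal C * ⨅ (U : Set X) (_ : IsOpen U) (_ : A ⊆ U), μ U := by
    intro A
    have hC0 : ENNReal.ofReal C ≠ 0 := (ENNReal.ofReal_pos.2 (by linarith)).ne'
    simp only [ENNReal.mul_iInf_of_ne hC0 ofReal_ne_top]
    exact iInf_mono fun U => iInf_mono fun _ => iInf_mono fun _ => packOpen_le μ q hr₀ hq₂ U
  refine ⟨fun A _ => ⟨hlower A, hupper A⟩, fun hreg A _ => ⟨hlower A, ?_⟩⟩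
  rw [A.measure_eq_iInf_isOpen μ]
  refine (hupper A).trans_eq ?_
  congr 1
  exact iInf_congr fun U => iInf_comm
end
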